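/- There exists ε₀ > 0, depending only on S and k, such that for every k-fission H of S within any ε ≤ ε₀ the following holds: if the halving edges graph of S is connected, then the number of vertices of every connected component of the halving edges graph of H is a multiple of n (the number of points of S). -/

import Mathlib

noncomputable section

/-- The plane. -/
abbrev Pt : Type := EuclideanSpace ℝ (Fin 2)

/-- Signed determinant of the triple `(p, q, r)`: positive iff `r` lies on the left of
the directed line from `p` to `q`. -/
def det2 (p q r : Pt) : ℝ :=
  (q 0 - p 0) * (r 1 - p 1) - (q 1 - p 1) * (r 0 - p 0)

/-- A finite set of points in the plane is in general position if no three of its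
(distinct) points are collinear. -/
def GenPos (S : Finset Pt) : Prop :=
  ∀ p ∈ S, ∀ q ∈ S, ∀ r ∈ S, p ≠ q → p ≠ r → q ≠ r →
    ¬ Collinear ℝ ({p, q, r} : Set Pt)

/-- `{p, q}` is a halving edge of `S`: `p, q` are distinct points of `S` and the open
half-planes on the two sides of the line through `p` and `q` each contain exactly
`(|S| - 2)/2` points of `S`. -/
def HalvingEdge (S : Finset Pt) (p q : Pt) : Prop :=
  p ∈ S ∧ q ∈ S ∧ p ≠ q ∧
    {r ∈ (S : Set Pt) | 0 < det2 p q r}.ncard = (S.card - 2) / 2 ∧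
    {r ∈ (S : Set Pt) | det2 p q r < 0}.ncard = (S.card - 2) / 2

/-- The halving edges graph of `S` (as a graph on the whole plane; all vertices
outside `S` are isolated). -/
def halvingGraph (S : Finset Pt) : SimpleGraph Pt :=
  SimpleGraph.fromRel (HalvingEdge S)

/-- The number of halving edges of `S`. -/
def halvingEdgeCount (S : Finset Pt) : ℕ :=
  {e : Sym2 Pt | ∃ p q, e = s(p, q) ∧ HalvingEdge S p q}.ncard

/-- `H`, together with the cluster map `cl`, is a `k`-fission of `S` within `ε`:
`H` is a set of `k * |S|` points in general position partitioned into clusters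
`cl v` of `k` points, one for each `v ∈ S`, with each point of the `v`-cluster
within distance `ε` of `v`. -/
structure IsFission (S : Finset Pt) (k : ℕ) (ε : ℝ) (H : Finset Pt)
    (cl : Pt → Finset Pt) : Prop where
  genPos : GenPos H
  cluster_card : ∀ v ∈ S, (cl v).card = k
  disj : ∀ v ∈ S, ∀ w ∈ S, v ≠ w → Disjoint (cl v) (cl w)
  union_eq : (H : Set Pt) = ⋃ v ∈ S, (cl v : Set Pt)
  close : ∀ v ∈ S, ∀ x ∈ cl v, dist x v ≤ ε

/-- A fission is plain if no halving edge of `H` has both endpoints in the same cluster. -/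
def IsPlain (S : Finset Pt) (H : Finset Pt) (cl : Pt → Finset Pt) : Prop :=
  ∀ v ∈ S, ∀ p ∈ cl v, ∀ q ∈ cl v, ¬ HalvingEdge H p q


local instance : DecidableEq Pt := Classical.decEq _

open scoped Classical in
/-- Net number of upward crossings from level `m` to level `m + 1` of the `±1`-walk which starts
at `b` and makes the step `σ r` at time `s r`. -/
lemma sum_crossings {α : Type*} (s : α → ℝ) (σ : α → ℤ) (b m : ℤ) (R : Finset α)
    (hinj : Set.InjOn s R) (hσ : ∀ r ∈ R, σ r = 1 ∨ σ r = -1) :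
    ∑ q ∈ R, (if b + ∑ r ∈ R with s r < s q, σ r + min (σ q) 0 = m then σ q else 0) =
      (if m + 1 ≤ b + ∑ r ∈ R, σ r then 1 else 0) - (if m + 1 ≤ b then 1 else 0) := by
  induction R using Finset.induction_on_max_value s with
  | empty => simp
  | insert a T ha hmax ih =>
    have hlt : ∀ x ∈ T, s x < s a := fun x hx => lt_of_le_of_ne (hmax x hx) fun h =>
      ha (hinj (Finset.mem_insert_of_mem hx) (Finset.mem_insert_self a T) h ▸ hx)
    have ih' := ih (hinj.mono (by simp)) fun r hr => hσ r (Finset.mem_insert_of_mem hr)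
    rw [Finset.sum_insert ha, Finset.sum_insert ha]
    have h1 : (insert a T).filter (fun r => s r < s a) = T := by
      ext r
      simp only [Finset.mem_filter, Finset.mem_insert]
      refine ⟨?_, fun h => ⟨Or.inr h, hlt r h⟩⟩
      rintro ⟨rfl | h, h'⟩
      · exact absurd h' (lt_irrefl _)
      · exact h
    have h2 : ∀ q ∈ T, (insert a T).filter (fun r => s r < s q) =
        T.filter (fun r => s r < s q) := fun q hq => by
      rw [Finset.filter_insert, if_neg (hlt q hq).le.not_gt]
    have h3 : ∑ q ∈ T, (if b + ∑ r ∈ insert a T with s r < s q, σ r + min (σ q) 0 = m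
        then σ q else 0) = _ :=
      (Finset.sum_congr rfl fun q hq => by rw [h2 q hq]).trans ih'
    rw [h1, h3]
    rcases hσ a (Finset.mem_insert_self a T) with h | h <;> rw [h] <;>
      split_ifs <;> omega

/-- Up to the factor `‖d‖`, the coordinate of `a` along the direction `d`. -/
def along (d a : Pt) : ℝ := d 0 * a 0 + d 1 * a 1

/-- Up to the factor `‖d‖`, the coordinate of `a` orthogonal to the direction `d`. -/
def across (d a : Pt) : ℝ := d 0 * a 1 - d 1 * a 0

/-- The line through `p` and `q` has slope less than `τ` with respect to the direction `d`. -/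
def InWedge (d : Pt) (τ : ℝ) (p q : Pt) : Prop :=
  |across d (q - p)| < τ * |along d (q - p)|

/-- The sign of `x`, as an integer (with value `-1` at `0`). -/
def orient (x : ℝ) : ℤ := if 0 < x then 1 else -1

lemma det2_swap (p q r : Pt) : det2 q p r = -det2 p q r := by
  simp only [det2]; ring

lemma across_sub (v w u : Pt) : across (w - v) (u - v) = det2 v w u := by
  simp [across, det2]

lemma along_neg_sub (d p q : Pt) : along d (p - q) = -along d (q - p) := by
  simp [along]; ring

lemma across_neg_sub (d p q : Pt) : across d (p - q) = -across d (q - p) := by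
  simp [across]; ring

lemma inWedge_comm {d : Pt} {τ : ℝ} {p q : Pt} : InWedge d τ p q ↔ InWedge d τ q p := by
  unfold InWedge
  rw [along_neg_sub d p q, across_neg_sub d p q, abs_neg, abs_neg]

lemma InWedge.along_ne_zero {d : Pt} {τ : ℝ} {p q : Pt} (h : InWedge d τ p q) :
    along d (q - p) ≠ 0 := fun h0 => by
  unfold InWedge at h
  rw [h0] at h
  simp only [abs_zero, mul_zero] at h
  exact absurd h (abs_nonneg _).not_gt

lemma normSq_pos {d : Pt} (hd : d ≠ 0) : 0 < d 0 ^ 2 + d 1 ^ 2 := by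
  by_contra h
  apply hd
  have h0 : d 0 = 0 := by nlinarith [sq_nonneg (d 0), sq_nonneg (d 1)]
  have h1 : d 1 = 0 := by nlinarith [sq_nonneg (d 0), sq_nonneg (d 1)]
  ext i
  fin_cases i <;> simp [h0, h1]

lemma normSq_mul_det2 (d p q r : Pt) : (d 0 ^ 2 + d 1 ^ 2) * det2 p q r =
    along d (q - p) * across d (r - p) - across d (q - p) * along d (r - p) := by
  simp [along, across, det2]; ring

lemma collinear_of_det2_eq_zero {p q r : Pt} (hpq : p ≠ q) (h : det2 p q r = 0) :
    Collinear ℝ ({p, q, r} : Set Pt) := by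
  have hd := normSq_pos (sub_ne_zero.mpr hpq.symm)
  rw [collinear_iff_of_mem (p₀ := p) (by simp)]
  refine ⟨q - p, ?_⟩
  simp only [Set.mem_insert_iff, Set.mem_singleton_iff, forall_eq_or_imp, forall_eq]
  refine ⟨⟨0, by simp⟩, ⟨1, by simp⟩,
    ⟨along (q - p) (r - p) / ((q - p) 0 ^ 2 + (q - p) 1 ^ 2), ?_⟩⟩
  simp only [det2] at h
  simp only [PiLp.sub_apply] at hd
  ext i
  fin_cases i <;> simp [along] <;> field_simp
  · linear_combination -(q 1 - p 1) * h
  · linear_combination (q 0 - p 0) * h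

lemma GenPos.det2_ne_zero {H : Finset Pt} (hH : GenPos H) {p q r : Pt} (hp : p ∈ H) (hq : q ∈ H)
    (hr : r ∈ H) (hpq : p ≠ q) (hpr : p ≠ r) (hqr : q ≠ r) : det2 p q r ≠ 0 := fun h =>
  hH p hp q hq r hr hpq hpr hqr (collinear_of_det2_eq_zero hpq h)

lemma HalvingEdge.symm {H : Finset Pt} {p q : Pt} (h : HalvingEdge H p q) :
    HalvingEdge H q p := by
  obtain ⟨hp, hq, hne, h1, h2⟩ := h
  refine ⟨hq, hp, hne.symm, ?_, ?_⟩
  · simpa [det2_swap p q] using h2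
  · simpa [det2_swap p q] using h1

lemma halvingEdge_comm {H : Finset Pt} {p q : Pt} : HalvingEdge H p q ↔ HalvingEdge H q p :=
  ⟨HalvingEdge.symm, HalvingEdge.symm⟩

lemma ncard_filter (H : Finset Pt) (P : Pt → Prop) [DecidablePred P] :
    {r ∈ (H : Set Pt) | P r}.ncard = (H.filter P).card := by
  rw [← Set.ncard_coe_finset]; simp

open scoped Classical in
lemma card_det2_neg_add_pos {H : Finset Pt} (hH : GenPos H) {p q : Pt} (hp : p ∈ H) (hq : q ∈ H)
    (hpq : p ≠ q) : (H.filter fun r => det2 p q r < 0).card +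
      (H.filter fun r => 0 < det2 p q r).card + 2 = H.card := by
  rw [← Finset.card_union_of_disjoint, ← Finset.card_pair hpq, ← Finset.card_union_of_disjoint]
  · congr 1
    ext r
    simp only [Finset.mem_union, Finset.mem_filter, Finset.mem_insert, Finset.mem_singleton]
    constructor
    · rintro ((h | h) | rfl | rfl)
      exacts [h.1, h.1, hp, hq]
    · intro hr
      by_cases h1 : r = p
      · exact Or.inr (Or.inl h1)
      by_cases h2 : r = q
      · exact Or.inr (Or.inr h2)
      rcases lt_or_gt_of_ne (hH.det2_ne_zero hp hq hr hpq (Ne.symm h1) (Ne.symm h2)) with h | h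
      · exact Or.inl (Or.inl ⟨hr, h⟩)
      · exact Or.inl (Or.inr ⟨hr, h⟩)
  · rw [Finset.disjoint_left]
    intro r hr
    simp only [Finset.mem_union, Finset.mem_filter, Finset.mem_insert, Finset.mem_singleton] at hr ⊢
    rintro (rfl | rfl)
    · have : det2 r q r = 0 := by simp [det2]
      rw [this] at hr
      simp at hr
    · have : det2 p r r = 0 := by simp [det2]; ring
      rw [this] at hr
      simp at hr
  · rw [Finset.disjoint_left]
    intro r hr
    simp only [Finset.mem_filter] at hr ⊢
    exact fun h => lt_asymm hr.2 h.2

open scoped Classical in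
lemma halvingEdge_iff_neg {H : Finset Pt} (hH : GenPos H) {p q : Pt} (hp : p ∈ H) (hq : q ∈ H)
    (hpq : p ≠ q) {m : ℕ} (hm : H.card = 2 * m + 2) :
    HalvingEdge H p q ↔ (H.filter fun r => det2 p q r < 0).card = m := by
  have := card_det2_neg_add_pos hH hp hq hpq
  unfold HalvingEdge
  rw [ncard_filter, ncard_filter]
  constructor
  · rintro ⟨-, -, -, -, h⟩
    omega
  · exact fun h => ⟨hp, hq, hpq, by omega, by omega⟩

/-- The slope of the line through `p` and `r` with respect to the direction `d`. -/
def slopeFrom (d p r : Pt) : ℝ := across d (r - p) / along d (r - p)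

lemma abs_slopeFrom_lt {d p q : Pt} {τ : ℝ} (h : InWedge d τ p q) : |slopeFrom d p q| < τ := by
  have h0 := abs_pos.mpr h.along_ne_zero
  rw [slopeFrom, abs_div, div_lt_iff₀ h0]
  exact h

/-- A point outside the wedge at `p` is on the same side of all lines of the wedge. -/
lemma across_sub_slope_neg_iff {d p q r : Pt} {τ : ℝ} (hq : InWedge d τ p q)
    (hr : ¬ InWedge d τ p r) :
    across d (r - p) - slopeFrom d p q * along d (r - p) < 0 ↔ across d (r - p) < 0 := by
  have h1 := abs_slopeFrom_lt hq
  rw [InWedge, not_lt] at hr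
  by_cases h0 : along d (r - p) = 0
  · simp [h0]
  have h2 : |slopeFrom d p q * along d (r - p)| < |across d (r - p)| := by
    rw [abs_mul]
    exact lt_of_lt_of_le (mul_lt_mul_of_pos_right h1 (abs_pos.mpr h0)) hr
  constructor
  · intro h
    by_contra h3
    rw [abs_of_nonneg (not_lt.mp h3)] at h2
    linarith [le_abs_self (slopeFrom d p q * along d (r - p))]
  · intro h
    rw [abs_of_neg h] at h2
    linarith [neg_abs_le (slopeFrom d p q * along d (r - p))]

lemma across_sub_slope_eq {d p r : Pt} (s : ℝ) (hr : along d (r - p) ≠ 0) :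
    across d (r - p) - s * along d (r - p) = (slopeFrom d p r - s) * along d (r - p) := by
  rw [slopeFrom]; field_simp

open scoped Classical in
/-- A wedge edge is halving iff the number of points of `H` below its line is right. -/
lemma halvingEdge_iff_below {H : Finset Pt} (hH : GenPos H) {p q d : Pt} {τ : ℝ} (hd : d ≠ 0)
    (hp : p ∈ H) (hq : q ∈ H) (hw : InWedge d τ p q) {m : ℕ} (hm : H.card = 2 * m + 2) :
    HalvingEdge H p q ↔
      (H.filter fun r => across d (r - p) - slopeFrom d p q * along d (r - p) < 0).card = m := by
  have hx := hw.along_ne_zero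
  have hpq : p ≠ q := by
    rintro rfl
    simp [along] at hx
  have hn := normSq_pos hd
  have key : ∀ r, (d 0 ^ 2 + d 1 ^ 2) * det2 p q r =
      along d (q - p) * (across d (r - p) - slopeFrom d p q * along d (r - p)) := fun r => by
    rw [normSq_mul_det2, slopeFrom]; field_simp
  rcases lt_or_gt_of_ne hx with h | h
  · rw [halvingEdge_comm, halvingEdge_iff_neg hH hq hp hpq.symm hm]
    have : ∀ r, det2 q p r < 0 ↔
        across d (r - p) - slopeFrom d p q * along d (r - p) < 0 := fun r => by
      rw [det2_swap]
      have := key r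
      constructor
      · intro h1; by_contra h2; nlinarith
      · intro h1; by_contra h2; nlinarith
    simp only [this]
  · rw [halvingEdge_iff_neg hH hp hq hpq hm]
    have : ∀ r, det2 p q r < 0 ↔
        across d (r - p) - slopeFrom d p q * along d (r - p) < 0 := fun r => by
      have := key r
      constructor
      · intro h1; by_contra h2; nlinarith
      · intro h1; by_contra h2; nlinarith
    simp only [this]

lemma slopeFrom_injOn {H : Finset Pt} (hH : GenPos H) {p d : Pt} {τ : ℝ} (hd : d ≠ 0)
    (hp : p ∈ H) : Set.InjOn (slopeFrom d p) {q | q ∈ H ∧ InWedge d τ p q} := by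
  rintro q ⟨hq, hqw⟩ r ⟨hr, hrw⟩ h
  by_contra hqr
  have ne : ∀ x, InWedge d τ p x → p ≠ x := by
    rintro x hx rfl
    exact hx.along_ne_zero (by simp [along])
  apply hH.det2_ne_zero hp hq hr (ne q hqw) (ne r hrw) hqr
  have h1 := normSq_mul_det2 d p q r
  have hn := normSq_pos hd
  have hq0 := hqw.along_ne_zero
  have hr0 := hrw.along_ne_zero
  unfold slopeFrom at h
  rw [div_eq_div_iff hq0 hr0] at h
  have : (d 0 ^ 2 + d 1 ^ 2) * det2 p q r = 0 := by rw [h1]; linarith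
  exact (mul_eq_zero.mp this).resolve_left hn.ne'

open scoped Classical in
/-- Rotating a line about `p` through the wedge: the halving edges at `p` in the wedge, counted
with their orientation, sum to `1` if the line starts at or below the halving level and ends
above it. -/
lemma sum_orient_halving {H : Finset Pt} (hH : GenPos H) {p d : Pt} {τ : ℝ} (hd : d ≠ 0)
    (hp : p ∈ H) {m : ℕ} (hm : H.card = 2 * m + 2)
    (hstart : (H.filter fun r => ¬ InWedge d τ p r ∧ across d (r - p) < 0).card +
      (H.filter fun r => InWedge d τ p r ∧ along d (r - p) < 0).card ≤ m)
    (hend : m + 1 ≤ (H.filter fun r => ¬ InWedge d τ p r ∧ across d (r - p) < 0).card +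
      (H.filter fun r => InWedge d τ p r ∧ 0 < along d (r - p)).card) :
    ∑ q ∈ H, (if InWedge d τ p q ∧ HalvingEdge H p q then orient (along d (q - p)) else 0) = 1 := by
  set R := H.filter fun r => InWedge d τ p r with hR
  set B := (H.filter fun r => ¬ InWedge d τ p r ∧ across d (r - p) < 0).card with hB
  set L := (H.filter fun r => InWedge d τ p r ∧ along d (r - p) < 0).card with hL
  set P := (H.filter fun r => InWedge d τ p r ∧ 0 < along d (r - p)).card with hP
  have hσ : ∀ r ∈ R, orient (along d (r - p)) = 1 ∨ orient (along d (r - p)) = -1 := by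
    intro r _
    unfold orient
    split_ifs <;> simp
  have hmem : ∀ r, r ∈ R ↔ r ∈ H ∧ InWedge d τ p r := fun r => by simp [hR]
  have hinj : Set.InjOn (slopeFrom d p) R :=
    (slopeFrom_injOn hH hd hp (τ := τ)).mono fun r hr => by simpa [hR] using hr
  have hsum : ∀ Q : Finset Pt, Q ⊆ R → ∑ r ∈ Q, orient (along d (r - p)) =
      ((Q.filter fun r => 0 < along d (r - p)).card : ℤ) -
        (Q.filter fun r => along d (r - p) < 0).card := by
    intro Q hQ
    rw [Finset.card_filter, Finset.card_filter]
    push_cast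
    rw [← Finset.sum_sub_distrib]
    refine Finset.sum_congr rfl fun r hr => ?_
    have hne := ((hmem r).1 (hQ hr)).2.along_ne_zero
    unfold orient
    rcases lt_or_gt_of_ne hne with h | h
    · simp [h, h.not_gt]
    · simp [h, h.not_gt]
  have hwalk := sum_crossings (slopeFrom d p) (fun r => orient (along d (r - p)))
    ((B : ℤ) + L) m R hinj hσ
  have htot : ∑ r ∈ R, orient (along d (r - p)) = (P : ℤ) - L := by
    rw [hsum R subset_rfl, hR, Finset.filter_filter, Finset.filter_filter]
  rw [htot, if_pos (by omega), if_neg (by omega)] at hwalk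
  rw [← Finset.sum_filter, ← Finset.filter_filter, ← hR, Finset.sum_filter]
  rw [sub_zero] at hwalk
  rw [← hwalk]
  refine Finset.sum_congr rfl fun q hq => ?_
  obtain ⟨hqH, hqw⟩ := (hmem q).1 hq
  refine if_congr ?_ rfl rfl
  rw [halvingEdge_iff_below hH hd hp hqH hqw hm, hsum _ (Finset.filter_subset _ _)]
  have hbelow : (H.filter fun r =>
        across d (r - p) - slopeFrom d p q * along d (r - p) < 0).card = B +
      ((R.filter fun r => slopeFrom d p r < slopeFrom d p q).filter
        fun r => 0 < along d (r - p)).card +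
      ((R.filter fun r => along d (r - p) < 0).filter
        fun r => slopeFrom d p q < slopeFrom d p r).card := by
    rw [hB, ← Finset.card_union_of_disjoint, ← Finset.card_union_of_disjoint]
    · congr 1
      ext r
      simp only [Finset.mem_union, Finset.mem_filter, hmem]
      by_cases hrH : r ∈ H
      swap
      · simp [hrH]
      by_cases hrw : InWedge d τ p r
      · simp only [hrH, hrw, true_and, not_true_eq_false, false_and, false_or]
        rw [across_sub_slope_eq _ hrw.along_ne_zero, mul_neg_iff, sub_pos, sub_neg]
        tauto
      · simp [hrH, hrw, across_sub_slope_neg_iff hqw hrw]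
    · rw [Finset.disjoint_left]
      intro r hr hr'
      simp only [Finset.mem_union, Finset.mem_filter, hmem] at hr hr'
      rcases hr with hr | hr
      · exact hr.2.1 hr'.1.1.2
      · exact lt_asymm hr.2 hr'.1.2
    · rw [Finset.disjoint_left]
      intro r hr hr'
      simp only [Finset.mem_filter, hmem] at hr hr'
      exact hr.2.1 hr'.1.1.2
  have hleft : L = ((R.filter fun r => slopeFrom d p r < slopeFrom d p q).filter
        fun r => along d (r - p) < 0).card +
      ((R.filter fun r => along d (r - p) < 0).filter
        fun r => slopeFrom d p q < slopeFrom d p r).card +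
      (if along d (q - p) < 0 then 1 else 0) := by
    have h1 : (if along d (q - p) < 0 then 1 else 0) =
        (({q} : Finset Pt).filter fun r => along d (r - p) < 0).card := by
      rw [Finset.filter_singleton]
      split_ifs <;> simp
    rw [h1, hL, ← Finset.card_union_of_disjoint, ← Finset.card_union_of_disjoint]
    · congr 1
      ext r
      simp only [Finset.mem_union, Finset.mem_filter, hmem, Finset.mem_singleton]
      constructor
      · rintro ⟨hr, hrw, hneg⟩
        rcases lt_trichotomy (slopeFrom d p r) (slopeFrom d p q) with h | h | h
        · tauto
        · exact Or.inr ⟨hinj (by simp [hR, hr, hrw]) hq h, hneg⟩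
        · tauto
      · rintro ((h | h) | ⟨rfl, h⟩) <;> tauto
    · rw [Finset.disjoint_left]
      intro r hr hr'
      simp only [Finset.mem_union, Finset.mem_filter, Finset.mem_singleton] at hr hr'
      obtain ⟨rfl, -⟩ := hr'
      rcases hr with hr | hr
      · exact lt_irrefl _ hr.1.2
      · exact lt_irrefl _ hr.2
    · rw [Finset.disjoint_left]
      intro r hr hr'
      simp only [Finset.mem_filter] at hr hr'
      exact lt_asymm hr.1.2 hr'.2
  rw [hbelow]
  have hmin : min (orient (along d (q - p))) 0 = -(if along d (q - p) < 0 then 1 else 0) := by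
    unfold orient
    rcases lt_or_gt_of_ne hqw.along_ne_zero with h | h
    · simp [h, h.not_gt]
    · simp [h, h.not_gt]
  rw [hmin]
  split_ifs at hleft ⊢ <;> omega

lemma IsFission.eq_biUnion {S H : Finset Pt} {k : ℕ} {ε : ℝ} {cl : Pt → Finset Pt}
    (hF : IsFission S k ε H cl) : H = S.biUnion cl := by
  apply Finset.coe_injective
  rw [hF.union_eq, Finset.coe_biUnion]
  rfl

lemma IsFission.card_biUnion {S H : Finset Pt} {k : ℕ} {ε : ℝ} {cl : Pt → Finset Pt}
    (hF : IsFission S k ε H cl) {T : Finset Pt} (hT : T ⊆ S) :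
    (T.biUnion cl).card = T.card * k := by
  rw [Finset.card_biUnion fun v hv w hw h => hF.disj v (hT hv) w (hT hw) h,
    Finset.sum_const_nat fun v hv => hF.cluster_card v (hT hv)]

/-- The clusters are so small, compared with the angle `τ`, that each wedge of angle `τ` around the
direction from `v` to `w`, with apex in the `v`-cluster, contains the `w`-cluster and avoids
all the other clusters. -/
structure IsSeparated (S : Finset Pt) (cl : Pt → Finset Pt) (τ : ℝ) : Prop where
  pos : 0 < τ
  near : ∀ v ∈ S, ∀ w ∈ S, v ≠ w → ∀ p ∈ cl v, ∀ q ∈ cl w,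
    |across (w - v) (q - p)| < τ * along (w - v) (q - p)
  left : ∀ v ∈ S, ∀ w ∈ S, ∀ u ∈ S, 0 < det2 v w u → ∀ p ∈ cl v, ∀ r ∈ cl u,
    τ * |along (w - v) (r - p)| < across (w - v) (r - p)
  right : ∀ v ∈ S, ∀ w ∈ S, ∀ u ∈ S, det2 v w u < 0 → ∀ p ∈ cl v, ∀ r ∈ cl u,
    τ * |along (w - v) (r - p)| < -across (w - v) (r - p)

section Separated

variable {S H : Finset Pt} {k : ℕ} {ε τ : ℝ} {cl : Pt → Finset Pt} {v w u p q r : Pt}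

lemma IsSeparated.inWedge (h : IsSeparated S cl τ) (hv : v ∈ S) (hw : w ∈ S) (hvw : v ≠ w)
    (hp : p ∈ cl v) (hq : q ∈ cl w) :
    InWedge (w - v) τ p q ∧ 0 < along (w - v) (q - p) := by
  have h1 := h.near v hv w hw hvw p hp q hq
  have h2 : 0 < along (w - v) (q - p) :=
    pos_of_mul_pos_right (lt_of_le_of_lt (abs_nonneg _) h1) h.pos.le
  exact ⟨by rwa [InWedge, abs_of_pos h2], h2⟩

lemma IsSeparated.not_inWedge (h : IsSeparated S cl τ) (hS : GenPos S) (hv : v ∈ S) (hw : w ∈ S)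
    (hu : u ∈ S) (hvw : v ≠ w) (hvu : v ≠ u) (hwu : w ≠ u) (hp : p ∈ cl v) (hr : r ∈ cl u) :
    ¬ InWedge (w - v) τ p r ∧ (across (w - v) (r - p) < 0 ↔ det2 v w u < 0) := by
  have h0 : 0 ≤ τ * |along (w - v) (r - p)| := mul_nonneg h.pos.le (abs_nonneg _)
  rw [InWedge, not_lt]
  rcases lt_or_gt_of_ne (hS.det2_ne_zero hv hw hu hvw hvu hwu) with hd | hd
  · have h1 := h.right v hv w hw u hu hd p hp r hr
    exact ⟨by linarith [neg_abs_le (across (w - v) (r - p))],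
      iff_of_true (by linarith) hd⟩
  · have h1 := h.left v hv w hw u hu hd p hp r hr
    exact ⟨by linarith [le_abs_self (across (w - v) (r - p))],
      iff_of_false (by linarith) hd.not_gt⟩

open scoped Classical in
/-- The oriented halving edges at a point of the `v`-cluster, in the direction of a halving
edge `vw` of `S`, sum to `1`. -/
lemma IsFission.sum_orient (hF : IsFission S k ε H cl) (hS : GenPos S) (hcard : Even S.card)
    (hk : 1 ≤ k) (h : IsSeparated S cl τ) (hvw : HalvingEdge S v w) (hp : p ∈ cl v) :
    ∑ q ∈ H, (if InWedge (w - v) τ p q ∧ HalvingEdge H p q then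
      orient (along (w - v) (q - p)) else 0) = 1 := by
  obtain ⟨hv, hw, hne, -, hneg⟩ := hvw
  rw [ncard_filter] at hneg
  have hH := hF.eq_biUnion
  have hmem : ∀ r, r ∈ H ↔ ∃ u ∈ S, r ∈ cl u := fun r => by rw [hH, Finset.mem_biUnion]
  have hpH : p ∈ H := (hmem p).2 ⟨v, hv, hp⟩
  obtain ⟨j, hj⟩ : ∃ j, S.card = 2 * (j + 1) := by
    obtain ⟨i, hi⟩ := hcard
    have : 0 < S.card := Finset.card_pos.2 ⟨v, hv⟩
    exact ⟨i - 1, by omega⟩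
  have hj' : (S.card - 2) / 2 = j := by omega
  rw [hj'] at hneg
  have hHcard : H.card = 2 * (j * k + (k - 1)) + 2 := by
    rw [hH, hF.card_biUnion subset_rfl, hj]
    obtain ⟨i, rfl⟩ := Nat.exists_eq_add_of_le hk
    simp only [Nat.add_sub_cancel_left]
    ring
  have hbelow := hF.card_biUnion (Finset.filter_subset (fun u => det2 v w u < 0) S)
  rw [hneg] at hbelow
  have hdet_v : det2 v w v = 0 := by simp [det2]
  have hdet_w : det2 v w w = 0 := by simp [det2]; ring
  refine sum_orient_halving hF.genPos (sub_ne_zero.2 hne.symm) hpH hHcard ?_ ?_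
  · rw [← Finset.card_union_of_disjoint]
    swap
    · rw [Finset.disjoint_left]
      intro r hr hr'
      simp only [Finset.mem_filter] at hr hr'
      exact hr.2.1 hr'.2.1
    rw [← hbelow, ← hF.cluster_card v hv, ← Finset.card_erase_of_mem hp]
    refine (Finset.card_le_card ?_).trans (Finset.card_union_le _ _)
    intro r hr
    simp only [Finset.mem_union, Finset.mem_filter, Finset.mem_biUnion, Finset.mem_erase,
      hmem] at hr ⊢
    obtain ⟨u, hu, hru⟩ : ∃ u ∈ S, r ∈ cl u := by tauto
    by_cases huv : u = v
    · subst huv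
      refine Or.inr ⟨?_, hru⟩
      rintro rfl
      simp [across, along] at hr
    by_cases huw : u = w
    · subst huw
      obtain ⟨h1, h2⟩ := h.inWedge hv hu hne hp hru
      rcases hr with hr | hr
      · exact absurd h1 hr.2.1
      · exact absurd h2 hr.2.2.not_gt
    · obtain ⟨h1, h2⟩ := h.not_inWedge hS hv hw hu hne (Ne.symm huv) (Ne.symm huw) hp hru
      rcases hr with hr | hr
      · exact Or.inl ⟨u, ⟨hu, h2.1 hr.2.2⟩, hru⟩
      · exact absurd hr.2.1 h1
  · refine le_trans ?_ (Finset.card_union_le _ _)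
    have hdisj : Disjoint ((S.filter fun u => det2 v w u < 0).biUnion cl) (cl w) := by
      rw [Finset.disjoint_biUnion_left]
      intro u hu
      rw [Finset.mem_filter] at hu
      refine hF.disj u hu.1 w hw ?_
      rintro rfl
      exact hu.2.ne hdet_w
    have hcard' := Finset.card_union_of_disjoint hdisj
    rw [hbelow, hF.cluster_card w hw] at hcard'
    refine le_trans (by omega : _ ≤ j * k + k) (hcard' ▸ Finset.card_le_card ?_)
    intro r hr
    simp only [Finset.mem_union, Finset.mem_filter, Finset.mem_biUnion, hmem] at hr ⊢
    rcases hr with ⟨u, ⟨hu, hdet⟩, hru⟩ | hr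
    · obtain ⟨h1, h2⟩ := h.not_inWedge hS hv hw hu hne
        (by rintro rfl; exact hdet.ne hdet_v) (by rintro rfl; exact hdet.ne hdet_w) hp hru
      exact Or.inl ⟨⟨u, hu, hru⟩, h1, h2.2 hdet⟩
    · exact Or.inr ⟨⟨w, hw, hr⟩, h.inWedge hv hw hne hp hr⟩

open scoped Classical in
/-- A union `C` of components has as many points in the `v`-cluster as it has halving edges
traversing the clusters of a halving edge `vw` of `S`. -/
lemma IsFission.card_inter_cluster (hF : IsFission S k ε H cl) (hS : GenPos S)
    (hcard : Even S.card) (hk : 1 ≤ k) (h : IsSeparated S cl τ) (hvw : HalvingEdge S v w)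
    {C : Finset Pt} (hCH : C ⊆ H) (hC : ∀ p ∈ C, ∀ q, HalvingEdge H p q → q ∈ C) :
    ((C ∩ cl v).card : ℤ) =
      ∑ p ∈ C ∩ cl v, ∑ q ∈ C ∩ cl w, if HalvingEdge H p q then 1 else 0 := by
  have hv := hvw.1
  have hw := hvw.2.1
  have hne := hvw.2.2.1
  set f : Pt → Pt → ℤ := fun p q => if InWedge (w - v) τ p q ∧ HalvingEdge H p q then
      orient (along (w - v) (q - p)) else 0 with hf
  have hdisj : Disjoint (C ∩ cl v) (C ∩ cl w) :=
    (hF.disj v hv w hw hne).mono Finset.inter_subset_right Finset.inter_subset_right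
  have hanti : ∀ p q, f q p = -f p q := by
    intro p q
    simp only [hf]
    rw [inWedge_comm, halvingEdge_comm]
    split_ifs with h1
    · rw [along_neg_sub]
      unfold orient
      rcases lt_or_gt_of_ne h1.1.along_ne_zero with h | h
      · simp [h, h.not_gt]
      · simp [h, h.not_gt]
    · simp
  have hzero : ∑ p ∈ C ∩ cl v, ∑ q ∈ C ∩ cl v, f p q = 0 := by
    have h1 : ∑ p ∈ C ∩ cl v, ∑ q ∈ C ∩ cl v, f p q =
        -∑ p ∈ C ∩ cl v, ∑ q ∈ C ∩ cl v, f p q := by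
      conv_lhs => rw [Finset.sum_comm]
      rw [← Finset.sum_neg_distrib]
      refine Finset.sum_congr rfl fun p _ => ?_
      rw [← Finset.sum_neg_distrib]
      exact Finset.sum_congr rfl fun q _ => hanti p q
    omega
  have hpoint : ∀ p ∈ C ∩ cl v,
      ∑ q ∈ C ∩ cl v, f p q + ∑ q ∈ C ∩ cl w, f p q = 1 := by
    intro p hp
    rw [Finset.mem_inter] at hp
    rw [← hF.sum_orient hS hcard hk h hvw hp.2, ← Finset.sum_union hdisj]
    refine Finset.sum_subset (Finset.union_subset (Finset.inter_subset_left.trans hCH)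
      (Finset.inter_subset_left.trans hCH)) fun q hq hq' => ?_
    simp only [hf]
    refine if_neg fun h1 => hq' ?_
    have hqC := hC p hp.1 q h1.2
    rw [hF.eq_biUnion, Finset.mem_biUnion] at hq
    obtain ⟨u, hu, hqu⟩ := hq
    rw [Finset.mem_union, Finset.mem_inter, Finset.mem_inter]
    by_cases huv : u = v
    · exact Or.inl ⟨hqC, huv ▸ hqu⟩
    by_cases huw : u = w
    · exact Or.inr ⟨hqC, huw ▸ hqu⟩
    exact absurd h1.1
      (h.not_inWedge hS hv hw hu hne (Ne.symm huv) (Ne.symm huw) hp.2 hqu).1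
  rw [Finset.card_eq_sum_ones]
  push_cast
  rw [← Finset.sum_congr rfl hpoint, Finset.sum_add_distrib, hzero, zero_add]
  refine Finset.sum_congr rfl fun p hp => Finset.sum_congr rfl fun q hq => ?_
  rw [Finset.mem_inter] at hp hq
  obtain ⟨h1, h2⟩ := h.inWedge hv hw hne hp.2 hq.2
  simp [hf, h1, orient, h2]

lemma IsFission.card_inter_cluster_eq (hF : IsFission S k ε H cl) (hS : GenPos S)
    (hcard : Even S.card) (hk : 1 ≤ k) (h : IsSeparated S cl τ) (hvw : HalvingEdge S v w)
    {C : Finset Pt} (hCH : C ⊆ H) (hC : ∀ p ∈ C, ∀ q, HalvingEdge H p q → q ∈ C) :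
    (C ∩ cl v).card = (C ∩ cl w).card := by
  classical
  have h1 := hF.card_inter_cluster hS hcard hk h hvw hCH hC
  have h2 := hF.card_inter_cluster hS hcard hk h hvw.symm hCH hC
  rw [Finset.sum_comm] at h2
  exact_mod_cast h1.trans (Eq.trans (Finset.sum_congr rfl fun p _ =>
    Finset.sum_congr rfl fun q _ => if_congr halvingEdge_comm rfl rfl) h2.symm)

end Separated

lemma continuous_along (d : Pt) : Continuous (along d) := by
  unfold along; fun_prop

lemma continuous_across (d : Pt) : Continuous (across d) := by
  unfold across; fun_prop

open Filter Topology in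
lemma eventually_forall_dist_le {v u : Pt} {P : Pt × Pt → Prop} (hP : IsOpen {z | P z})
    (h : P (v, u)) :
    ∀ᶠ ε : ℝ in 𝓝[>] 0, ∀ p r, dist p v ≤ ε → dist r u ≤ ε → P (p, r) := by
  obtain ⟨δ, hδ, hball⟩ := Metric.isOpen_iff.1 hP (v, u) h
  filter_upwards [Ioo_mem_nhdsGT hδ] with ε hε p r hp hr
  apply hball
  rw [Metric.mem_ball, Prod.dist_eq]
  exact max_lt (hp.trans_lt hε.2) (hr.trans_lt hε.2)

open Filter Topology in
lemma exists_forall_mul_lt (S : Finset Pt) :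
    ∃ τ > 0, ∀ v ∈ S, ∀ w ∈ S, ∀ u ∈ S, det2 v w u ≠ 0 →
      τ * |along (w - v) (u - v)| < |det2 v w u| := by
  have h : ∀ᶠ τ : ℝ in 𝓝[>] 0, ∀ v ∈ S, ∀ w ∈ S, ∀ u ∈ S, det2 v w u ≠ 0 →
      τ * |along (w - v) (u - v)| < |det2 v w u| := by
    simp only [Filter.eventually_all_finset, Filter.eventually_imp_distrib_left]
    intro v _ w _ u _ hne
    have h1 : Tendsto (fun τ : ℝ => τ * |along (w - v) (u - v)|) (𝓝[>] 0) (𝓝 0) := by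
      have : Tendsto (fun τ : ℝ => τ * |along (w - v) (u - v)|) (𝓝 0)
          (𝓝 (0 * |along (w - v) (u - v)|)) := by
        apply Continuous.tendsto; fun_prop
      rw [zero_mul] at this
      exact this.mono_left nhdsWithin_le_nhds
    exact h1.eventually_lt_const (abs_pos.2 hne)
  obtain ⟨τ, hτ, hpos⟩ := (h.and self_mem_nhdsWithin).exists
  exact ⟨τ, hpos, hτ⟩

open Filter Topology in
lemma exists_isSeparated (S : Finset Pt) :
    ∃ τ : ℝ, ∃ ε₀ > 0, ∀ ε : ℝ, 0 < ε → ε ≤ ε₀ → ∀ cl : Pt → Finset Pt,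
      (∀ v ∈ S, ∀ x ∈ cl v, dist x v ≤ ε) → IsSeparated S cl τ := by
  obtain ⟨τ, hτ, hτS⟩ := exists_forall_mul_lt S
  have hnear : ∀ᶠ ε : ℝ in 𝓝[>] 0, ∀ v ∈ S, ∀ w ∈ S, v ≠ w → ∀ p q, dist p v ≤ ε →
      dist q w ≤ ε → |across (w - v) (q - p)| < τ * along (w - v) (q - p) := by
    simp only [Filter.eventually_all_finset, Filter.eventually_imp_distrib_left]
    intro v _ w _ hne
    refine eventually_forall_dist_le
      (P := fun z => |across (w - v) (z.2 - z.1)| < τ * along (w - v) (z.2 - z.1)) ?_ ?_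
    · have h1 := continuous_along (w - v)
      have h2 := continuous_across (w - v)
      exact isOpen_lt (by fun_prop) (by fun_prop)
    · have h1 := normSq_pos (sub_ne_zero.2 hne.symm)
      have h2 : across (w - v) (w - v) = 0 := by unfold across; ring
      have h3 : along (w - v) (w - v) = (w - v) 0 ^ 2 + (w - v) 1 ^ 2 := by unfold along; ring
      simp only [h2, h3, abs_zero]
      exact mul_pos hτ h1
  have hleft : ∀ᶠ ε : ℝ in 𝓝[>] 0, ∀ v ∈ S, ∀ w ∈ S, ∀ u ∈ S, 0 < det2 v w u → ∀ p r,
      dist p v ≤ ε → dist r u ≤ ε →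
      τ * |along (w - v) (r - p)| < across (w - v) (r - p) := by
    simp only [Filter.eventually_all_finset, Filter.eventually_imp_distrib_left]
    intro v hv w hw u hu hdet
    refine eventually_forall_dist_le
      (P := fun z => τ * |along (w - v) (z.2 - z.1)| < across (w - v) (z.2 - z.1)) ?_ ?_
    · have h1 := continuous_along (w - v)
      have h2 := continuous_across (w - v)
      exact isOpen_lt (by fun_prop) (by fun_prop)
    · have h1 := hτS v hv w hw u hu hdet.ne'
      rwa [abs_of_pos hdet, ← across_sub] at h1
  have hright : ∀ᶠ ε : ℝ in 𝓝[>] 0, ∀ v ∈ S, ∀ w ∈ S, ∀ u ∈ S, det2 v w u < 0 → ∀ p r,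
      dist p v ≤ ε → dist r u ≤ ε →
      τ * |along (w - v) (r - p)| < -across (w - v) (r - p) := by
    simp only [Filter.eventually_all_finset, Filter.eventually_imp_distrib_left]
    intro v hv w hw u hu hdet
    refine eventually_forall_dist_le
      (P := fun z => τ * |along (w - v) (z.2 - z.1)| < -across (w - v) (z.2 - z.1)) ?_ ?_
    · have h1 := continuous_along (w - v)
      have h2 := continuous_across (w - v)
      exact isOpen_lt (by fun_prop) (by fun_prop)
    · have h1 := hτS v hv w hw u hu hdet.ne
      rwa [abs_of_neg hdet, ← across_sub] at h1
  obtain ⟨ε₀, hε₀, hsub⟩ := mem_nhdsGT_iff_exists_Ioc_subset.1 (hnear.and (hleft.and hright))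
  refine ⟨τ, ε₀, hε₀, fun ε hε hle cl hcl => ?_⟩
  obtain ⟨h1, h2, h3⟩ := hsub ⟨hε, hle⟩
  exact ⟨hτ,
    fun v hv w hw hne p hp q hq => h1 v hv w hw hne p q (hcl v hv p hp) (hcl w hw q hq),
    fun v hv w hw u hu hd p hp r hr => h2 v hv w hw u hu hd p r (hcl v hv p hp) (hcl u hu r hr),
    fun v hv w hw u hu hd p hp r hr => h3 v hv w hw u hu hd p r (hcl v hv p hp) (hcl u hu r hr)⟩

lemma halvingEdge_of_adj {S : Finset Pt} {p q : Pt} (h : (halvingGraph S).Adj p q) :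
    HalvingEdge S p q := by
  rw [halvingGraph, SimpleGraph.fromRel_adj] at h
  exact h.2.elim id HalvingEdge.symm

lemma HalvingEdge.adj {S : Finset Pt} {p q : Pt} (h : HalvingEdge S p q) :
    (halvingGraph S).Adj p q := by
  rw [halvingGraph, SimpleGraph.fromRel_adj]
  exact ⟨h.2.2.1, Or.inl h⟩

lemma mem_of_reachable {H : Finset Pt} {x y : Pt} (hx : x ∈ H)
    (h : (halvingGraph H).Reachable x y) : y ∈ H := by
  obtain ⟨p⟩ := h
  induction p with
  | nil => exact hx
  | cons hadj _ ih => exact ih (halvingEdge_of_adj hadj).2.1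

theorem stmt12 (S : Finset Pt) (hS : GenPos S) (hcard : Even S.card)
    (k : ℕ) (hk : 1 ≤ k) :
    ∃ ε₀ > 0, ∀ ε : ℝ, 0 < ε → ε ≤ ε₀ →
      ∀ (H : Finset Pt) (cl : Pt → Finset Pt), IsFission S k ε H cl →
        (∀ p ∈ S, ∀ q ∈ S, (halvingGraph S).Reachable p q) →
          ∀ x ∈ H, S.card ∣ {y : Pt | (halvingGraph H).Reachable x y}.ncard := by
  classical
  obtain ⟨τ, ε₀, hε₀, hsep⟩ := exists_isSeparated S
  refine ⟨ε₀, hε₀, fun ε hε hle H cl hF hconn x hx => ?_⟩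
  have h := hsep ε hε hle cl hF.close
  set C : Finset Pt := H.filter fun y => (halvingGraph H).Reachable x y with hC
  have hcoe : {y : Pt | (halvingGraph H).Reachable x y} = (C : Set Pt) := by
    ext y
    simp only [hC, Set.mem_ofPred_eq, Finset.coe_filter]
    exact ⟨fun hy => ⟨mem_of_reachable hx hy, hy⟩, fun hy => hy.2⟩
  have hCH : C ⊆ H := Finset.filter_subset _ _
  have hclosed : ∀ p ∈ C, ∀ q, HalvingEdge H p q → q ∈ C := fun p hp q hpq => by
    rw [hC, Finset.mem_filter] at hp ⊢
    exact ⟨hpq.2.1, hp.2.trans hpq.adj.reachable⟩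
  have heq : ∀ v w, (halvingGraph S).Reachable v w → (C ∩ cl v).card = (C ∩ cl w).card := by
    rintro v w ⟨p⟩
    induction p with
    | nil => rfl
    | cons hadj _ ih =>
      exact (hF.card_inter_cluster_eq hS hcard hk h (halvingEdge_of_adj hadj) hCH hclosed).trans ih
  obtain ⟨v, hv, -⟩ : ∃ v ∈ S, x ∈ cl v := by
    rwa [hF.eq_biUnion, Finset.mem_biUnion] at hx
  rw [hcoe, Set.ncard_coe_finset]
  have hunion : C = S.biUnion fun w => C ∩ cl w := by
    rw [← Finset.inter_biUnion, ← hF.eq_biUnion, Finset.inter_eq_left.2 hCH]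
  rw [hunion, Finset.card_biUnion fun a ha b hb hab =>
      (hF.disj a ha b hb hab).mono Finset.inter_subset_right Finset.inter_subset_right,
    Finset.sum_const_nat fun w hw => heq w v (hconn w hw v hv)]
  exact dvd_mul_right _ _

end
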